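/- (Brown's lemma, ring-theoretic form.) Let H be a prime Noetherian ring whose center Z is a finitely generated ℂ-algebra, and suppose H is finitely generated as a module over Z. Suppose there is an idempotent e ∈ H such that the map Z → eHe sending z to ze is a ring isomorphism onto eHe. Let m be a maximal ideal of Z such that there is exactly one maximal two-sided ideal M of H with M ∩ Z = m. Then the central localization H_m = (Z∖m)⁻¹H is isomorphic, as an algebra over the local ring Z_m = (Z∖m)⁻¹Z, to a matrix algebra Mat_n(Z_m) for some n ≥ 1; in particular H_m and Z_m are Morita equivalent. -/

import Mathlib

open scoped TensorProduct

set_option synthInstance.maxHeartbeats 1000000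

namespace CornerIdempotent

variable {R A : Type*} [CommRing R] [Ring A] [Algebra R A]

/-- The two-sided ideal generated by `e`, as an `R`-submodule. -/
def sandwich (R : Type*) {A : Type*} [CommRing R] [Ring A] [Algebra R A] (e : A) :
    Submodule R A :=
  Submodule.span R {x | ∃ a b, a * e * b = x}

theorem mul_mem_sandwich {e x : A} (hx : x ∈ sandwich R e) (c d : A) :
    c * x * d ∈ sandwich R e := by
  induction hx using Submodule.span_induction with
  | mem x hx =>
    obtain ⟨a, b, rfl⟩ := hx
    exact Submodule.subset_span ⟨c * a, b * d, by simp only [mul_assoc]⟩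
  | zero => simp
  | add x y _ _ hx hy => simpa only [mul_add, add_mul] using add_mem hx hy
  | smul r x _ hx => simpa only [mul_smul_comm, smul_mul_assoc] using Submodule.smul_mem _ r hx

theorem exists_sum_of_mem_sandwich {e x : A} (hx : x ∈ sandwich R e) :
    ∃ (k : ℕ) (a b : Fin k → A), ∑ i, a i * e * b i = x := by
  obtain ⟨k, r, y, rfl⟩ := Submodule.mem_span_set'.1 hx
  choose a b hab using fun i => (y i).2
  exact ⟨k, fun i => r i • a i, b, by simp [← hab]⟩

theorem mul_mem_smul_top {m : Ideal R} {x : A} (hx : x ∈ m • (⊤ : Submodule R A)) (c d : A) :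
    c * x * d ∈ m • (⊤ : Submodule R A) := by
  induction hx using Submodule.smul_induction_on' with
  | smul r hr x _ =>
    simpa only [mul_smul_comm, smul_mul_assoc] using
      Submodule.smul_mem_smul hr (Submodule.mem_top (x := c * x * d))
  | add x _ y _ hx hy => simpa only [mul_add, add_mul] using add_mem hx hy

/-- A submodule stable under two-sided multiplication, as a two-sided ideal. -/
def toTwoSidedIdeal (P : Submodule R A) (hP : ∀ x ∈ P, ∀ c d, c * x * d ∈ P) :
    TwoSidedIdeal A :=
  TwoSidedIdeal.mk' P P.zero_mem P.add_mem P.neg_mem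
    (fun {c x} hx => by simpa using hP x hx c 1) (fun {x d} hx => by simpa using hP x hx 1 d)

theorem mem_toTwoSidedIdeal {P : Submodule R A} {hP : ∀ x ∈ P, ∀ c d, c * x * d ∈ P} {x : A} :
    x ∈ toTwoSidedIdeal P hP ↔ x ∈ P :=
  TwoSidedIdeal.mem_mk' ..

theorem apply_mul_mul {e : A} {φ : A →ₗ[R] R} (hφ : ∀ x, e * x * e = φ x • e) (hφe : φ e = 1)
    (x y : A) : φ (x * e * y) = φ x * φ y := by
  have key : φ (x * e * y) • e = (φ x * φ y) • e := by
    rw [← hφ, show e * (x * e * y) * e = (e * x * e) * y * e by simp only [mul_assoc], hφ,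
      smul_mul_assoc, smul_mul_assoc, hφ, smul_smul]
  simpa [hφe] using congrArg φ key

/-- If `eAe = Re` and `AeA = A` over a local ring `R`, then `A` is a matrix algebra over `R`. -/
theorem exists_matrix_algEquiv [IsLocalRing R] {e : A} (he : e * e = e) {φ : A →ₗ[R] R}
    (hφ : ∀ x, e * x * e = φ x • e) (hφe : φ e = 1) (hfull : (1 : A) ∈ sandwich R e) :
    ∃ n : ℕ, 0 < n ∧ Nonempty (A ≃ₐ[R] Matrix (Fin n) (Fin n) R) := by
  obtain ⟨k, a, b, hab⟩ := exists_sum_of_mem_sandwich hfull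
  let P : Ideal A := Ideal.span {e}
  have hmem : ∀ x, x * e ∈ P := fun x => Ideal.mul_mem_left _ _ (Ideal.mem_span_singleton_self e)
  have hright : ∀ x ∈ P, x * e = x := by
    intro x hx
    obtain ⟨y, rfl⟩ := Ideal.mem_span_singleton'.1 hx
    rw [mul_assoc, he]
  have hexp : ∀ x ∈ P, ∑ i, φ (b i * x) • (a i * e) = x := by
    intro x hx
    calc ∑ i, φ (b i * x) • (a i * e) = ∑ i, a i * e * b i * x := by
          refine Finset.sum_congr rfl fun i _ => ?_
          rw [← mul_smul_comm, ← hφ]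
          simp only [mul_assoc, hright x hx]
      _ = x := by rw [← Finset.sum_mul, hab, one_mul]
  let i : P →ₗ[R] (Fin k → R) :=
    LinearMap.pi fun j => φ ∘ₗ LinearMap.mulLeft R (b j) ∘ₗ (P.restrictScalars R).subtype
  have hi : ∀ x j, i x j = φ (b j * x) := fun _ _ => rfl
  let s : (Fin k → R) →ₗ[R] P := Fintype.linearCombination R fun j => (⟨a j * e, hmem _⟩ : P)
  have hsi : s ∘ₗ i = LinearMap.id := by
    ext x
    simpa [s, hi, Fintype.linearCombination_apply] using hexp x x.2
  have : Module.Projective R P := Module.Projective.of_split i s hsi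
  have : Module.Finite R P := Module.Finite.of_surjective s fun x => ⟨i x, congr($hsi x)⟩
  have : Module.Free R P := Module.free_of_flat_of_isLocalRing
  have : Nontrivial P := by
    refine ⟨⟨⟨e, by simpa [he] using hmem e⟩, 0, fun h => ?_⟩⟩
    have h0 : e = 0 := congrArg Subtype.val h
    rw [h0, map_zero] at hφe
    exact zero_ne_one hφe
  have hbij : Function.Bijective (Algebra.lsmul R R P : A →ₐ[R] Module.End R P) := by
    constructor
    · rw [injective_iff_map_eq_zero]
      intro x hx
      rw [← mul_one x, ← hab, Finset.mul_sum]
      refine Finset.sum_eq_zero fun j _ => ?_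
      have h1 : x * (a j * e) = 0 := congrArg Subtype.val congr($hx ⟨a j * e, hmem _⟩)
      rw [← mul_assoc, h1, zero_mul]
    · intro f
      let g : Fin k → P := fun j => f ⟨a j * e, hmem _⟩
      refine ⟨∑ j, (g j : A) * b j, ?_⟩
      ext x
      have hx : s (i x) = x := congr($hsi x)
      have h1 : f x = ∑ j, φ (b j * x) • g j := by
        conv_lhs => rw [← hx]
        simp only [s, Fintype.linearCombination_apply, hi, map_sum, map_smul, g]
      have h2 : ∀ j, φ (b j * x) • (g j : A) = g j * b j * x := by
        intro j
        conv_lhs => rw [← hright _ (g j).2]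
        rw [← mul_smul_comm, ← hφ]
        simp only [← mul_assoc, hright _ (g j).2]
        simp only [mul_assoc, hright _ x.2]
      rw [h1]
      simp [mul_assoc, h2]
  refine ⟨Module.finrank R P, (Module.finrank_pos_iff_of_free R P).2 this,
    ⟨(AlgEquiv.ofBijective _ hbij).trans (LinearMap.toMatrixAlgEquiv (Module.finBasis R P))⟩⟩

/-- The bilinear form `(a, b) ↦ φ (a * b)` modulo `m` has finite rank, so it is represented by
an element of `AeA` up to the ideal it annihilates. -/
theorem exists_mem_sandwich_sub [Module.Finite R A] (m : Ideal R) [m.IsMaximal] {e : A}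
    {φ : A →ₗ[R] R} (hφ : ∀ x, e * x * e = φ x • e) (hφe : φ e = 1) :
    ∃ x ∈ sandwich R e, ∀ a b, φ (a * (1 - x) * b) ∈ m := by
  obtain ⟨k, c, hc⟩ := Module.Finite.exists_fin (R := R) (M := A)
  let ψ : A →ₗ[R] (Fin k → R ⧸ m) :=
    LinearMap.pi fun j => m.mkQ ∘ₗ φ ∘ₗ LinearMap.mulLeft R (c j)
  have : IsSimpleModule R (R ⧸ m) := isSimpleModule_iff_isCoatom.2 (Ideal.isMaximal_def.1 ‹_›)
  obtain ⟨h, hh⟩ := IsSemisimpleModule.extension_property (LinearMap.range ψ).subtype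
    (Submodule.injective_subtype _) LinearMap.id
  choose v hv using fun j => (h (Pi.single j 1)).2
  have hψ : ∀ b, ψ b = ∑ j, φ (c j * b) • ψ (v j) := by
    intro b
    have h1 : h (ψ b) = ⟨ψ b, b, rfl⟩ := congr($hh ⟨ψ b, b, rfl⟩)
    have h2 : ψ b = ∑ j, φ (c j * b) • (Pi.single j 1 : Fin k → R ⧸ m) := by
      ext i
      simp [ψ, Pi.single_apply, Finset.sum_apply, Algebra.smul_def]
    calc ψ b = h (ψ b) := (congrArg Subtype.val h1).symm
      _ = h (∑ j, φ (c j * b) • (Pi.single j 1 : Fin k → R ⧸ m)) := by rw [← h2]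
      _ = ∑ j, φ (c j * b) • ψ (v j) := by simp [hv]
  have key : ∀ a b, φ (a * b) - ∑ j, φ (a * v j) * φ (c j * b) ∈ m := by
    intro a b
    have ha : a ∈ Submodule.span R (Set.range c) := hc ▸ Submodule.mem_top
    induction ha using Submodule.span_induction with
    | mem x hx =>
      obtain ⟨i, rfl⟩ := hx
      rw [← Ideal.Quotient.eq]
      simpa [ψ, Algebra.smul_def, mul_comm] using congrFun (hψ b) i
    | zero => simp
    | add x y _ _ hx hy =>
      convert! add_mem hx hy using 1
      simp only [add_mul, map_add, Finset.sum_add_distrib]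
      ring
    | smul r x _ hx =>
      convert! m.mul_mem_left r hx using 1
      simp only [smul_mul_assoc, map_smul, smul_eq_mul, mul_sub, Finset.mul_sum, mul_assoc]
  refine ⟨∑ j, v j * e * c j, Submodule.sum_mem _ fun j _ =>
    Submodule.subset_span ⟨_, _, rfl⟩, fun a b => ?_⟩
  convert! key a b using 1
  rw [mul_sub, mul_one, sub_mul, map_sub, Finset.mul_sum, Finset.sum_mul, map_sum]
  congr 1
  refine Finset.sum_congr rfl fun j _ => ?_
  rw [← apply_mul_mul hφ hφe]
  simp only [mul_assoc]

theorem exists_isCoatom_twoSidedIdeal [IsNoetherianRing A] {I : TwoSidedIdeal A} (hI : I ≠ ⊤) :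
    ∃ M, IsCoatom M ∧ I ≤ M := by
  have hmono : StrictMono (TwoSidedIdeal.asIdeal (R := A)) :=
    TwoSidedIdeal.asIdeal.monotone.strictMono_of_injective fun I J h =>
      SetLike.ext fun x => by simpa using SetLike.ext_iff.1 h x
  have : WellFoundedGT (TwoSidedIdeal A) := hmono.wellFoundedGT
  exact (eq_top_or_exists_le_coatom I).resolve_left hI

theorem ne_top_of_one_notMem {I : TwoSidedIdeal A} (h : (1 : A) ∉ I) : I ≠ ⊤ := by
  rintro rfl
  exact h (TwoSidedIdeal.mem_top A)

theorem one_notMem_of_ne_top {I : TwoSidedIdeal A} (h : I ≠ ⊤) : (1 : A) ∉ I := fun h1 =>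
  h <| SetLike.ext fun x => ⟨fun _ => TwoSidedIdeal.mem_top A,
    fun _ => by simpa using I.mul_mem_left x 1 h1⟩

/-- If `m` has only one maximal two-sided ideal above it, then `AeA` meets `R \ m`. -/
theorem exists_notMem_algebraMap_mem_sandwich [IsNoetherianRing A] [Module.Finite R A]
    (m : Ideal R) [hm : m.IsMaximal] {e : A} {φ : A →ₗ[R] R}
    (hφ : ∀ x, e * x * e = φ x • e) (hφe : φ e = 1)
    (huniq : ∃! M : TwoSidedIdeal A, IsCoatom M ∧ ∀ r : R, algebraMap R A r ∈ M ↔ r ∈ m) :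
    ∃ r, r ∉ m ∧ algebraMap R A r ∈ sandwich R e := by
  obtain ⟨M, ⟨hM, -⟩, hMuniq⟩ := huniq
  have hle : ∀ I : TwoSidedIdeal A, I ≠ ⊤ → (∀ r ∈ m, algebraMap R A r ∈ I) → I ≤ M := by
    intro I hI hmI
    obtain ⟨M', hM', hIM'⟩ := exists_isCoatom_twoSidedIdeal hI
    have hmM' : m = M'.asIdeal.comap (algebraMap R A) :=
      hm.eq_of_le (by
        rw [Ne, Ideal.eq_top_iff_one, Ideal.mem_comap, map_one, TwoSidedIdeal.mem_asIdeal]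
        exact one_notMem_of_ne_top hM'.1) fun r hr => by simpa using hIM' (hmI r hr)
    rw [← hMuniq M' ⟨hM', fun r => by
      conv_rhs => rw [hmM', Ideal.mem_comap, TwoSidedIdeal.mem_asIdeal]⟩]
    exact hIM'
  have heM : e ∉ M := by
    intro heM
    obtain ⟨x, hx, hxm⟩ := exists_mem_sandwich_sub m hφ hφe
    let N : TwoSidedIdeal A := TwoSidedIdeal.mk' {x | ∀ a b, φ (a * x * b) ∈ m}
      (fun a b => by simp)
      (fun hx hy a b => by simpa only [mul_add, add_mul, map_add] using add_mem (hx a b) (hy a b))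
      (fun hx a b => by simpa only [mul_neg, neg_mul, map_neg] using neg_mem (hx a b))
      (fun {c x} hx a b => by simpa only [mul_assoc] using hx (a * c) b)
      (fun {x d} hx a b => by simpa only [mul_assoc] using hx a (d * b))
    have hN : ∀ x, x ∈ N ↔ ∀ a b, φ (a * x * b) ∈ m := fun x => TwoSidedIdeal.mem_mk' ..
    have hNM : N ≤ M := by
      refine hle N (ne_top_of_one_notMem fun h1 => ?_) fun r hr => (hN _).2 fun a b => ?_
      · have h2 := (hN 1).1 h1 e 1
        rw [mul_one, mul_one, hφe] at h2
        exact hm.ne_top ((Ideal.eq_top_iff_one m).2 h2)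
      · rw [← Algebra.commutes, ← Algebra.smul_def, smul_mul_assoc, map_smul]
        exact m.mul_mem_right _ hr
    have hxM : x ∈ M := by
      obtain ⟨k, a, b, rfl⟩ := exists_sum_of_mem_sandwich hx
      exact sum_mem fun i _ => M.mul_mem_right _ _ (M.mul_mem_left _ _ heM)
    refine one_notMem_of_ne_top hM.1 ?_
    simpa using M.add_mem (hNM ((hN _).2 hxm)) hxM
  have hTm : sandwich R e ⊔ m • (⊤ : Submodule R A) = ⊤ := by
    set P := sandwich R e ⊔ m • (⊤ : Submodule R A) with hPdef
    have hP : ∀ x ∈ P, ∀ c d, c * x * d ∈ P := by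
      intro x hx c d
      obtain ⟨y, hy, z, hz, rfl⟩ := Submodule.mem_sup.1 hx
      rw [mul_add, add_mul]
      exact Submodule.add_mem_sup (mul_mem_sandwich hy c d) (mul_mem_smul_top hz c d)
    have htop : toTwoSidedIdeal P hP = ⊤ := by
      by_contra hne
      refine heM (hle _ hne (fun r hr => mem_toTwoSidedIdeal.2 ?_) (mem_toTwoSidedIdeal.2 ?_))
      · rw [Algebra.algebraMap_eq_smul_one]
        exact Submodule.mem_sup_right (Submodule.smul_mem_smul hr trivial)
      · exact Submodule.mem_sup_left (Submodule.subset_span ⟨1, 1, by simp⟩)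
    exact eq_top_iff.2 fun x _ => mem_toTwoSidedIdeal.1 (htop ▸ TwoSidedIdeal.mem_top A)
  obtain ⟨r, hr, hr'⟩ := Submodule.exists_sub_one_mem_and_smul_eq_zero_of_fg_of_le_smul m
    (⊤ : Submodule R (A ⧸ sandwich R e)) Module.Finite.fg_top (by
      rw [← Submodule.range_mkQ, ← Submodule.map_top, ← Submodule.map_smul'', ← hTm,
        Submodule.map_sup, hTm]
      exact sup_le ((Submodule.map_mono le_rfl).trans (by simp)) le_rfl)
  refine ⟨r, fun hrm => hm.ne_top ((Ideal.eq_top_iff_one m).2 ?_), ?_⟩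
  · simpa using m.sub_mem hrm hr
  · have := hr' ((sandwich R e).mkQ 1) trivial
    rwa [← map_smul, Submodule.mkQ_apply, Submodule.Quotient.mk_eq_zero,
      ← Algebra.algebraMap_eq_smul_one] at this

/-- If `eAe = Re` and `AeA` contains an element of `R` that is invertible in the local ring `S`,
then the base change of `A` to `S` is a matrix algebra over `S`. -/
theorem exists_matrix_algEquiv_baseChange {S : Type*} [CommRing S] [Algebra R S] [IsLocalRing S]
    {e : A} (he : e * e = e) {φ : A →ₗ[R] R} (hφ : ∀ x, e * x * e = φ x • e) (hφe : φ e = 1)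
    {r : R} (hr : IsUnit (algebraMap R S r)) (hre : algebraMap R A r ∈ sandwich R e) :
    ∃ n : ℕ, 0 < n ∧ Nonempty ((S ⊗[R] A) ≃ₐ[S] Matrix (Fin n) (Fin n) S) := by
  let φ' : S ⊗[R] A →ₗ[S] S := (Algebra.TensorProduct.rid R S S).toLinearMap ∘ₗ φ.baseChange S
  have hφ' : ∀ s x, φ' (s ⊗ₜ x) = φ x • s := fun s x => by simp [φ']
  refine exists_matrix_algEquiv (e := (1 : S) ⊗ₜ[R] e) (φ := φ') (by simp [he]) (fun x => ?_)
    (by simp [hφ', hφe]) ?_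
  · induction x with
    | zero => simp
    | tmul s x =>
      rw [hφ', Algebra.TensorProduct.tmul_mul_tmul, Algebra.TensorProduct.tmul_mul_tmul, hφ,
        TensorProduct.tmul_smul, TensorProduct.smul_tmul', TensorProduct.smul_tmul', one_mul,
        mul_one, smul_eq_mul, mul_one]
    | add x y hx hy => rw [mul_add, add_mul, hx, hy, map_add, add_smul]
  · obtain ⟨k, a, b, hab⟩ := exists_sum_of_mem_sandwich hre
    obtain ⟨u, hu⟩ := hr
    have h1 : (1 : S ⊗[R] A) =
        ∑ i, ((u⁻¹ : Sˣ) : S) • ((1 : S) ⊗ₜ[R] a i * 1 ⊗ₜ[R] e * 1 ⊗ₜ[R] b i) := by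
      simp only [Algebra.TensorProduct.tmul_mul_tmul, mul_one]
      rw [← Finset.smul_sum, ← TensorProduct.tmul_sum, hab, Algebra.algebraMap_eq_smul_one,
        TensorProduct.tmul_smul, TensorProduct.smul_tmul', TensorProduct.smul_tmul',
        smul_eq_mul, ← Algebra.algebraMap_eq_smul_one, ← hu, Units.inv_mul]
      rfl
    rw [h1]
    exact Submodule.sum_mem _ fun i _ =>
      Submodule.smul_mem _ _ (Submodule.subset_span ⟨_, _, rfl⟩)

/-- A bijection `R → eAe`, `r ↦ re`, yields the linear functional representing the corner. -/
theorem exists_linearMap_of_corner {e : A} (he : e * e = e)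
    (hinj : Function.Injective fun r : R => r • e) (hsurj : ∀ x, ∃ r : R, r • e = e * x * e) :
    ∃ φ : A →ₗ[R] R, (∀ x, e * x * e = φ x • e) ∧ φ e = 1 := by
  choose f hf using hsurj
  refine ⟨{ toFun := f, map_add' := fun x y => hinj ?_, map_smul' := fun r x => hinj ?_ },
    fun x => (hf x).symm, hinj ?_⟩
  · simp only [hf, add_smul, mul_add, add_mul]
  · simp only [hf, smul_eq_mul, mul_smul, RingHom.id_apply, mul_smul_comm, smul_mul_assoc]
  · simp [hf, he]

end CornerIdempotent

/-- Brown's lemma, ring-theoretic form: if `H` is a prime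
Noetherian ℂ-algebra, module-finite over its centre `Z` (a finitely generated
ℂ-algebra), `e ∈ H` is an idempotent with `Z ≅ eHe` via `z ↦ ze`, and `m` is a
maximal ideal of `Z` over which there lies exactly one maximal two-sided ideal
of `H`, then the central localisation `H_m = Z_m ⊗_Z H` is a matrix algebra
`Mat_n(Z_m)` over the local ring `Z_m`; in particular `H_m` and `Z_m` are
Morita equivalent. -/
theorem browns_lemma
    (H : Type*) [Ring H] [Algebra ℂ H]
    -- `H` is prime:
    (hprime : ∀ a b : H, (∀ r : H, a * r * b = 0) → a = 0 ∨ b = 0)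
    -- `H` is Noetherian:
    [IsNoetherianRing H]
    -- the centre `Z` is a finitely generated ℂ-algebra:
    [Algebra.FiniteType ℂ ↥(Subalgebra.center ℂ H)]
    -- `H` is finitely generated as a module over its centre `Z`:
    [Module.Finite ↥(Subring.center H) H]
    -- `e` is an idempotent such that `z ↦ ze` is a ring isomorphism of `Z`
    -- onto `eHe` (the map is automatically additive and multiplicative with
    -- `1 ↦ e`, so we require it to be a bijection onto `eHe = {x | exe = x}`):
    (e : H) (he : e * e = e)
    (hinj : Function.Injective fun z : ↥(Subring.center H) => (z : H) * e)
    (hsurj : Set.range (fun z : ↥(Subring.center H) => (z : H) * e) =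
      {x : H | e * x * e = x})
    -- `m` is a maximal ideal of `Z`:
    (m : Ideal ↥(Subring.center H)) [m.IsMaximal]
    -- there is exactly one maximal two-sided ideal `M` of `H` with `M ∩ Z = m`:
    (huniq : ∃! M : TwoSidedIdeal H,
      (M ≠ ⊤ ∧ ∀ N : TwoSidedIdeal H, M < N → N = ⊤) ∧
      (∀ z : ↥(Subring.center H), (z : H) ∈ M ↔ z ∈ m)) :
    ∃ n : ℕ, 0 < n ∧
      Nonempty ((Localization.AtPrime m ⊗[↥(Subring.center H)] H)
        ≃ₐ[Localization.AtPrime m]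
          Matrix (Fin n) (Fin n) (Localization.AtPrime m)) := by
  obtain ⟨φ, hφ, hφe⟩ := CornerIdempotent.exists_linearMap_of_corner (R := Subring.center H) he
    hinj fun x => by
      have hx : e * x * e ∈ {x : H | e * x * e = x} := by
        change e * (e * x * e) * e = e * x * e
        simp only [mul_assoc, he]
        simp only [← mul_assoc, he]
      rw [← hsurj] at hx
      exact hx
  have huniq' : ∃! M : TwoSidedIdeal H, IsCoatom M ∧
      ∀ r : Subring.center H, algebraMap (Subring.center H) H r ∈ M ↔ r ∈ m := huniq
  obtain ⟨r, hr, hre⟩ :=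
    CornerIdempotent.exists_notMem_algebraMap_mem_sandwich m hφ hφe huniq'
  exact CornerIdempotent.exists_matrix_algEquiv_baseChange he hφ hφe
    (IsLocalization.map_units (Localization.AtPrime m) (⟨r, hr⟩ : m.primeCompl)) hre
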